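/- The map A ↦ ∇Ω[A] is a bijection from the space of symmetric n×n real matrices onto the cone of symmetric positive definite n×n matrices, and its inverse is the map G ↦ ∇𝓕[G]. -/

import Mathlib

open MeasureTheory Matrix Filter Topology Real Asymptotics

attribute [local instance] Matrix.normedAddCommGroup Matrix.normedSpace

noncomputable section

/-- The partition function `Z[A] = ∫ exp(-½ xᵀAx - U(x)) dx`. -/
def Zfun (n : ℕ) (U : (Fin n → ℝ) → ℝ) (A : Matrix (Fin n) (Fin n) ℝ) : ℝ :=
  ∫ x : Fin n → ℝ, Real.exp (-(1 / 2) * (x ⬝ᵥ A.mulVec x) - U x)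

/-- The free energy `Ω[A] = -log Z[A]`. -/
def Omega (n : ℕ) (U : (Fin n → ℝ) → ℝ) (A : Matrix (Fin n) (Fin n) ℝ) : ℝ :=
  - Real.log (Zfun n U A)

/-- `U` is continuous with superquadratic growth: for every `c > 0`,
`U x - c * |x|² → +∞` as `|x| → ∞`. -/
def SuperQuadratic {n : ℕ} (U : (Fin n → ℝ) → ℝ) : Prop :=
  Continuous U ∧ ∀ c : ℝ, 0 < c →
    Tendsto (fun x : Fin n → ℝ => U x - c * ‖x‖ ^ 2) (cocompact _) atTop

/-- A probability density on `ℝⁿ` with finite second moments and finite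
differential entropy. -/
def IsGoodDensity {n : ℕ} (ρ : (Fin n → ℝ) → ℝ) : Prop :=
  Measurable ρ ∧ (∀ x, 0 ≤ ρ x) ∧ (∫ x, ρ x) = 1 ∧
  (∀ i j : Fin n, Integrable fun x => x i * x j * ρ x) ∧
  Integrable fun x => ρ x * Real.log (ρ x)

/-- Differential entropy `S(ρ) = -∫ ρ log ρ`. -/
def entropy {n : ℕ} (ρ : (Fin n → ℝ) → ℝ) : ℝ := - ∫ x, ρ x * Real.log (ρ x)

/-- Second-moment matrix `𝒢(ρ) = ∫ x xᵀ ρ(x) dx`. -/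
def momMatrix {n : ℕ} (ρ : (Fin n → ℝ) → ℝ) : Matrix (Fin n) (Fin n) ℝ :=
  Matrix.of fun i j => ∫ x, x i * x j * ρ x

/-- `𝓕[G;U] = sup { S(ρ) - ∫ U ρ : ρ ∈ 𝓜, 𝒢(ρ) = G }`. -/
def Ffun (n : ℕ) (U : (Fin n → ℝ) → ℝ) (G : Matrix (Fin n) (Fin n) ℝ) : ℝ :=
  sSup { r : ℝ | ∃ ρ : (Fin n → ℝ) → ℝ, IsGoodDensity ρ ∧
    (Integrable fun x => U x * ρ x) ∧ momMatrix ρ = G ∧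
    r = entropy ρ - ∫ x, U x * ρ x }

/-- The Luttinger-Ward functional `Φ[G;U] = 2𝓕[G;U] - Tr[log G] - n log(2πe)`.
(For positive definite `G`, `Tr[log G] = log det G`.) -/
def Phi (n : ℕ) (U : (Fin n → ℝ) → ℝ) (G : Matrix (Fin n) (Fin n) ℝ) : ℝ :=
  2 * Ffun n U G - Real.log G.det - (n : ℝ) * Real.log (2 * π * Real.exp 1)

/-- The continuous linear functional `H ↦ Tr[S * H]` on matrices. -/
def tracePairing {n : ℕ} (S : Matrix (Fin n) (Fin n) ℝ) :
    Matrix (Fin n) (Fin n) ℝ →L[ℝ] ℝ :=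
  LinearMap.toContinuousLinearMap
    { toFun := fun H => (S * H).trace
      map_add' := fun H K => by simp [Matrix.mul_add]
      map_smul' := fun c H => by simp [Matrix.mul_smul] }


lemma qf_eq {n : ℕ} (A : Matrix (Fin n) (Fin n) ℝ) (x : Fin n → ℝ) :
    x ⬝ᵥ A.mulVec x = ∑ i, ∑ j, A i j * (x i * x j) := by
  simp only [dotProduct, mulVec, Finset.mul_sum]
  refine Finset.sum_congr rfl fun i _ => Finset.sum_congr rfl fun j _ => by ring

lemma abs_coord_mul_le {n : ℕ} (x : Fin n → ℝ) (i j : Fin n) : |x i * x j| ≤ ‖x‖ ^ 2 := by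
  rw [abs_mul, sq]
  have h1 := norm_le_pi_norm x i
  have h2 := norm_le_pi_norm x j
  rw [Real.norm_eq_abs] at h1 h2
  gcongr

lemma qf_bound {n : ℕ} (A : Matrix (Fin n) (Fin n) ℝ) (x : Fin n → ℝ) :
    |x ⬝ᵥ A.mulVec x| ≤ (∑ i, ∑ j, |A i j|) * ‖x‖ ^ 2 := by
  rw [qf_eq, Finset.sum_mul]
  refine (Finset.abs_sum_le_sum_abs _ _).trans (Finset.sum_le_sum fun i _ => ?_)
  rw [Finset.sum_mul]
  refine (Finset.abs_sum_le_sum_abs _ _).trans (Finset.sum_le_sum fun j _ => ?_)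
  rw [abs_mul]
  exact mul_le_mul_of_nonneg_left (abs_coord_mul_le x i j) (abs_nonneg _)

lemma qf_cont {n : ℕ} (A : Matrix (Fin n) (Fin n) ℝ) :
    Continuous fun x : Fin n → ℝ => x ⬝ᵥ A.mulVec x := by
  simp only [qf_eq]
  fun_prop

lemma U_lower {n : ℕ} {U : (Fin n → ℝ) → ℝ} (hU : SuperQuadratic U) (c : ℝ) (hc : 0 < c) :
    ∃ K : ℝ, ∀ x, c * ‖x‖ ^ 2 - K ≤ U x := by
  have hcont : Continuous fun x : Fin n → ℝ => U x - c * ‖x‖ ^ 2 := by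
    have := hU.1
    fun_prop
  obtain ⟨x0, hx0⟩ := hcont.exists_forall_le (hU.2 c hc)
  refine ⟨-(U x0 - c * ‖x0‖ ^ 2), fun x => ?_⟩
  have := hx0 x
  linarith

lemma integrable_gauss (n : ℕ) : Integrable fun x : Fin n → ℝ => Real.exp (-(n * ‖x‖ ^ 2)) := by
  have h1 : Integrable fun x : Fin n → ℝ => ∏ i, Real.exp (-1 * x i ^ 2) :=
    Integrable.fintype_prod (f := fun _ t => Real.exp (-1 * t ^ 2))
      fun i => integrable_exp_neg_mul_sq one_pos
  refine h1.mono' (by fun_prop) (ae_of_all _ fun x => ?_)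
  rw [Real.norm_eq_abs, abs_of_pos (Real.exp_pos _), ← Real.exp_sum]
  apply Real.exp_le_exp.2
  simp only [neg_one_mul, Finset.sum_neg_distrib]
  apply neg_le_neg
  calc ∑ i, x i ^ 2 ≤ ∑ i : Fin n, ‖x‖ ^ 2 := by
        refine Finset.sum_le_sum fun i _ => ?_
        have := (le_abs_self _).trans (abs_coord_mul_le x i i)
        rwa [← sq] at this
    _ = n * ‖x‖ ^ 2 := by simp

lemma integrable_exp_gen {n : ℕ} {U : (Fin n → ℝ) → ℝ} (hU : SuperQuadratic U) (a b : ℝ)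
    (hb : 0 < b) : Integrable fun x : Fin n → ℝ => Real.exp (a * ‖x‖ ^ 2 - b * U x) := by
  obtain ⟨K, hK⟩ := U_lower hU ((|a| + n + 1) / b) (by positivity)
  have hUc := hU.1
  refine ((integrable_gauss n).mul_const (Real.exp (b * K))).mono' (by fun_prop)
    (ae_of_all _ fun x => ?_)
  rw [Real.norm_eq_abs, abs_of_pos (Real.exp_pos _), ← Real.exp_add]
  apply Real.exp_le_exp.2
  have h1 := mul_le_mul_of_nonneg_left (hK x) hb.le
  have h2 : b * ((|a| + n + 1) / b * ‖x‖ ^ 2 - K) = (|a| + n + 1) * ‖x‖ ^ 2 - b * K := by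
    field_simp
  rw [h2] at h1
  have h3 : a * ‖x‖ ^ 2 ≤ |a| * ‖x‖ ^ 2 := mul_le_mul_of_nonneg_right (le_abs_self a) (by positivity)
  nlinarith [sq_nonneg ‖x‖]

/-- Boltzmann weight -/
def wt {n : ℕ} (U : (Fin n → ℝ) → ℝ) (A : Matrix (Fin n) (Fin n) ℝ) (x : Fin n → ℝ) : ℝ :=
  Real.exp (-(1 / 2) * (x ⬝ᵥ A.mulVec x) - U x)

lemma wt_cont {n : ℕ} {U : (Fin n → ℝ) → ℝ} (hU : SuperQuadratic U)
    (A : Matrix (Fin n) (Fin n) ℝ) : Continuous (wt U A) := by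
  have h1 := hU.1
  have h2 := qf_cont A
  unfold wt
  fun_prop

lemma wt_le {n : ℕ} (U : (Fin n → ℝ) → ℝ) (A : Matrix (Fin n) (Fin n) ℝ) (x : Fin n → ℝ) :
    wt U A x ≤ Real.exp ((∑ i, ∑ j, |A i j|) * ‖x‖ ^ 2 - 1 * U x) := by
  apply Real.exp_le_exp.2
  have h1 := qf_bound A x
  have h2 := neg_abs_le (x ⬝ᵥ A.mulVec x)
  have h3 := abs_nonneg (x ⬝ᵥ A.mulVec x)
  linarith

lemma wt_int {n : ℕ} {U : (Fin n → ℝ) → ℝ} (hU : SuperQuadratic U)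
    (A : Matrix (Fin n) (Fin n) ℝ) : Integrable (wt U A) := by
  refine (integrable_exp_gen hU (∑ i, ∑ j, |A i j|) 1 one_pos).mono'
    (wt_cont hU A).aestronglyMeasurable (ae_of_all _ fun x => ?_)
  rw [Real.norm_eq_abs, abs_of_pos (show 0 < wt U A x from Real.exp_pos _)]
  exact wt_le U A x

lemma wt_mom_int {n : ℕ} {U : (Fin n → ℝ) → ℝ} (hU : SuperQuadratic U)
    (A : Matrix (Fin n) (Fin n) ℝ) (i j : Fin n) :
    Integrable fun x => x i * x j * wt U A x := by
  have h := wt_cont hU A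
  refine (integrable_exp_gen hU ((∑ i, ∑ j, |A i j|) + 1) 1 one_pos).mono'
    (Continuous.aestronglyMeasurable (by fun_prop)) (ae_of_all _ fun x => ?_)
  rw [Real.norm_eq_abs, abs_mul, abs_of_pos (show 0 < wt U A x from Real.exp_pos _)]
  have h1 : |x i * x j| ≤ Real.exp (‖x‖ ^ 2) :=
    (abs_coord_mul_le x i j).trans (by linarith [Real.add_one_le_exp (‖x‖ ^ 2)])
  calc |x i * x j| * wt U A x
      ≤ Real.exp (‖x‖ ^ 2) * Real.exp ((∑ i, ∑ j, |A i j|) * ‖x‖ ^ 2 - 1 * U x) :=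
        mul_le_mul h1 (wt_le U A x) (Real.exp_pos _).le (Real.exp_pos _).le
    _ = _ := by rw [← Real.exp_add]; congr 1; ring

lemma wt_U_int {n : ℕ} {U : (Fin n → ℝ) → ℝ} (hU : SuperQuadratic U)
    (A : Matrix (Fin n) (Fin n) ℝ) : Integrable fun x => U x * wt U A x := by
  have h := wt_cont hU A
  have hUc := hU.1
  obtain ⟨K, hK⟩ := U_lower hU 1 one_pos
  set a := ∑ i, ∑ j, |A i j|
  refine (((integrable_exp_gen hU a (1 / 2) (by norm_num)).const_mul 2).add
    ((integrable_exp_gen hU a 1 one_pos).const_mul (2 * |K|))).mono'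
    (Continuous.aestronglyMeasurable (by fun_prop)) (ae_of_all _ fun x => ?_)
  rw [Real.norm_eq_abs, abs_mul, abs_of_pos (show 0 < wt U A x from Real.exp_pos _)]
  have h1 : |U x| ≤ 2 * Real.exp (1 / 2 * U x) + 2 * |K| := by
    have e1 := Real.add_one_le_exp (1 / 2 * U x)
    have e2 := hK x
    have e3 := le_abs_self K
    have e4 := abs_nonneg K
    have e5 := sq_nonneg ‖x‖
    have e6 := Real.exp_pos (1 / 2 * U x)
    exact abs_le.2 ⟨by linarith, by linarith⟩
  calc |U x| * wt U A x
      ≤ (2 * Real.exp (1 / 2 * U x) + 2 * |K|) * Real.exp (a * ‖x‖ ^ 2 - 1 * U x) :=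
        mul_le_mul h1 (wt_le U A x) (Real.exp_pos _).le (by positivity)
    _ = 2 * (Real.exp (1 / 2 * U x) * Real.exp (a * ‖x‖ ^ 2 - 1 * U x)) +
        2 * |K| * Real.exp (a * ‖x‖ ^ 2 - 1 * U x) := by ring
    _ = _ := by
      rw [← Real.exp_add]
      simp only [Pi.add_apply]
      congr 3
      ring

lemma Z_pos {n : ℕ} {U : (Fin n → ℝ) → ℝ} (hU : SuperQuadratic U)
    (A : Matrix (Fin n) (Fin n) ℝ) : 0 < Zfun n U A :=
  integral_exp_pos (wt_int hU A)

/-- Gibbs density -/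
def gd {n : ℕ} (U : (Fin n → ℝ) → ℝ) (A : Matrix (Fin n) (Fin n) ℝ) (x : Fin n → ℝ) : ℝ :=
  wt U A x * (Zfun n U A)⁻¹

lemma gd_pos {n : ℕ} {U : (Fin n → ℝ) → ℝ} (hU : SuperQuadratic U)
    (A : Matrix (Fin n) (Fin n) ℝ) (x : Fin n → ℝ) : 0 < gd U A x :=
  mul_pos (Real.exp_pos _) (inv_pos.2 (Z_pos hU A))

lemma gd_log {n : ℕ} {U : (Fin n → ℝ) → ℝ} (hU : SuperQuadratic U)
    (A : Matrix (Fin n) (Fin n) ℝ) (x : Fin n → ℝ) :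
    Real.log (gd U A x) = -(1 / 2) * (x ⬝ᵥ A.mulVec x) - U x + Omega n U A := by
  unfold gd wt Omega
  rw [Real.log_mul (Real.exp_pos _).ne' (inv_pos.2 (Z_pos hU A)).ne', Real.log_exp, Real.log_inv]

lemma gd_int {n : ℕ} {U : (Fin n → ℝ) → ℝ} (hU : SuperQuadratic U)
    (A : Matrix (Fin n) (Fin n) ℝ) : Integrable (gd U A) := (wt_int hU A).mul_const _

lemma gd_integral {n : ℕ} {U : (Fin n → ℝ) → ℝ} (hU : SuperQuadratic U)
    (A : Matrix (Fin n) (Fin n) ℝ) : ∫ x, gd U A x = 1 := by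
  unfold gd
  rw [integral_mul_const]
  exact mul_inv_cancel₀ (Z_pos hU A).ne'

lemma gd_mom_int {n : ℕ} {U : (Fin n → ℝ) → ℝ} (hU : SuperQuadratic U)
    (A : Matrix (Fin n) (Fin n) ℝ) (i j : Fin n) :
    Integrable fun x => x i * x j * gd U A x := by
  refine ((wt_mom_int hU A i j).mul_const (Zfun n U A)⁻¹).congr (ae_of_all _ fun x => ?_)
  simp only [gd]; ring

lemma gd_U_int {n : ℕ} {U : (Fin n → ℝ) → ℝ} (hU : SuperQuadratic U)
    (A : Matrix (Fin n) (Fin n) ℝ) : Integrable fun x => U x * gd U A x := by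
  refine ((wt_U_int hU A).mul_const (Zfun n U A)⁻¹).congr (ae_of_all _ fun x => ?_)
  simp only [gd]; ring

lemma qf_int {n : ℕ} {ρ : (Fin n → ℝ) → ℝ}
    (h : ∀ i j : Fin n, Integrable fun x => x i * x j * ρ x) (A : Matrix (Fin n) (Fin n) ℝ) :
    Integrable fun x => (x ⬝ᵥ A.mulVec x) * ρ x := by
  have : (fun x => (x ⬝ᵥ A.mulVec x) * ρ x) =
      fun x => ∑ i, ∑ j, A i j * (x i * x j * ρ x) := by
    funext x
    simp only [qf_eq, Finset.sum_mul, mul_assoc]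
  rw [this]
  exact integrable_finsetSum _ fun i _ => integrable_finsetSum _ fun j _ => (h i j).const_mul _

lemma mom_symm {n : ℕ} (ρ : (Fin n → ℝ) → ℝ) : (momMatrix ρ).IsSymm := by
  ext i j
  simp only [momMatrix, Matrix.transpose_apply, Matrix.of_apply]
  congr 1; funext x; ring

lemma qf_integral {n : ℕ} {ρ : (Fin n → ℝ) → ℝ}
    (h : ∀ i j : Fin n, Integrable fun x => x i * x j * ρ x) (A : Matrix (Fin n) (Fin n) ℝ) :
    ∫ x, (x ⬝ᵥ A.mulVec x) * ρ x = (A * momMatrix ρ).trace := by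
  have : (fun x => (x ⬝ᵥ A.mulVec x) * ρ x) =
      fun x => ∑ i, ∑ j, A i j * (x i * x j * ρ x) := by
    funext x
    simp only [qf_eq, Finset.sum_mul, mul_assoc]
  rw [this, integral_finsetSum (f := fun i x => ∑ j, A i j * (x i * x j * ρ x)) _
    fun i _ => integrable_finsetSum _ fun j _ => (h i j).const_mul _]
  simp only [Matrix.trace, Matrix.diag, Matrix.mul_apply]
  refine Finset.sum_congr rfl fun i _ => ?_
  rw [integral_finsetSum (f := fun j x => A i j * (x i * x j * ρ x)) _
    fun j _ => (h i j).const_mul _]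
  refine Finset.sum_congr rfl fun j _ => ?_
  rw [integral_const_mul, (mom_symm ρ).apply i j]
  rfl

lemma gd_log_int {n : ℕ} {U : (Fin n → ℝ) → ℝ} (hU : SuperQuadratic U)
    (A : Matrix (Fin n) (Fin n) ℝ) {ρ : (Fin n → ℝ) → ℝ} (hρi : Integrable ρ)
    (hm : ∀ i j : Fin n, Integrable fun x => x i * x j * ρ x)
    (hUi : Integrable fun x => U x * ρ x) :
    Integrable (fun x => ρ x * Real.log (gd U A x)) ∧
    ∫ x, ρ x * Real.log (gd U A x) =
      -(1 / 2) * (A * momMatrix ρ).trace - (∫ x, U x * ρ x) + Omega n U A * ∫ x, ρ x := by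
  have e : (fun x => ρ x * Real.log (gd U A x)) = fun x =>
      -(1 / 2) * ((x ⬝ᵥ A.mulVec x) * ρ x) - U x * ρ x + Omega n U A * ρ x := by
    funext x
    rw [gd_log hU]; ring
  have i1 := (qf_int hm A).const_mul (-(1 / 2))
  have i3 := hρi.const_mul (Omega n U A)
  rw [e]
  refine ⟨(i1.sub hUi).add i3, ?_⟩
  have i2 : Integrable fun x => -(1 / 2) * ((x ⬝ᵥ A.mulVec x) * ρ x) - U x * ρ x := i1.sub hUi
  rw [integral_add i2 i3, integral_sub i1 hUi, integral_const_mul, integral_const_mul,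
    qf_integral hm]

lemma gd_good {n : ℕ} {U : (Fin n → ℝ) → ℝ} (hU : SuperQuadratic U)
    (A : Matrix (Fin n) (Fin n) ℝ) : IsGoodDensity (gd U A) :=
  ⟨((wt_cont hU A).mul continuous_const).measurable, fun x => (gd_pos hU A x).le,
    gd_integral hU A, gd_mom_int hU A,
    (gd_log_int hU A (gd_int hU A) (gd_mom_int hU A) (gd_U_int hU A)).1⟩

lemma good_int {n : ℕ} {ρ : (Fin n → ℝ) → ℝ} (h : IsGoodDensity ρ) : Integrable ρ := by
  by_contra hc
  have := h.2.2.1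
  rw [integral_undef hc] at this
  exact zero_ne_one this

lemma gd_val {n : ℕ} {U : (Fin n → ℝ) → ℝ} (hU : SuperQuadratic U)
    (A : Matrix (Fin n) (Fin n) ℝ) :
    entropy (gd U A) - ∫ x, U x * gd U A x =
      1 / 2 * (A * momMatrix (gd U A)).trace - Omega n U A := by
  have := (gd_log_int hU A (gd_int hU A) (gd_mom_int hU A) (gd_U_int hU A)).2
  unfold entropy
  rw [this, gd_integral hU]
  ring

lemma gibbs {n : ℕ} {U : (Fin n → ℝ) → ℝ} (hU : SuperQuadratic U)
    (A : Matrix (Fin n) (Fin n) ℝ) {ρ : (Fin n → ℝ) → ℝ} (h : IsGoodDensity ρ)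
    (hUi : Integrable fun x => U x * ρ x) :
    entropy ρ - ∫ x, U x * ρ x ≤ 1 / 2 * (A * momMatrix ρ).trace - Omega n U A := by
  obtain ⟨l1, l2⟩ := gd_log_int hU A (good_int h) h.2.2.2.1 hUi
  have key : ∫ x, (ρ x - gd U A x) ≤ ∫ x, (ρ x * Real.log (ρ x) - ρ x * Real.log (gd U A x)) := by
    refine integral_mono ((good_int h).sub (gd_int hU A)) (h.2.2.2.2.sub l1) fun x => ?_
    have hp := gd_pos hU A x
    simp only
    rcases (h.2.1 x).eq_or_lt with h0 | h0
    · rw [← h0]; simp; exact hp.le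
    · have := Real.log_le_sub_one_of_pos (div_pos hp h0)
      rw [Real.log_div hp.ne' h0.ne'] at this
      have h2 := mul_le_mul_of_nonneg_left this h0.le
      rw [mul_sub, mul_sub, mul_div_cancel₀ _ h0.ne'] at h2
      linarith
  rw [integral_sub (good_int h) (gd_int hU A), integral_sub h.2.2.2.2 l1, l2, h.2.2.1,
    gd_integral hU] at key
  unfold entropy
  linarith

lemma mom_posDef {n : ℕ} {ρ : (Fin n → ℝ) → ℝ}
    (h : ∀ i j : Fin n, Integrable fun x => x i * x j * ρ x) (h0 : ∀ x, 0 ≤ ρ x)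
    (hb : ∀ x ∈ Metric.ball (0 : Fin n → ℝ) 1, 0 < ρ x) : (momMatrix ρ).PosDef := by
  refine Matrix.PosDef.of_dotProduct_mulVec_pos ?_ ?_
  · rw [Matrix.IsHermitian, Matrix.conjTranspose_eq_transpose_of_trivial]
    exact mom_symm ρ
  · intro v hv
    have e1 : star v ⬝ᵥ (momMatrix ρ *ᵥ v) = (vecMulVec v v * momMatrix ρ).trace := by
      rw [Matrix.vecMulVec_mul, Matrix.trace_vecMulVec, star_trivial, Matrix.dotProduct_mulVec,
        dotProduct_comm]
    have e2 : ∀ x : Fin n → ℝ, x ⬝ᵥ (vecMulVec v v).mulVec x = (v ⬝ᵥ x) ^ 2 := by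
      intro x
      rw [Matrix.vecMulVec_mulVec]
      simp [dotProduct_comm x v, sq]
    have hi := qf_int h (vecMulVec v v)
    rw [e1, ← qf_integral h, integral_pos_iff_support_of_nonneg _ hi]
    · have hc : Continuous fun x : Fin n → ℝ => v ⬝ᵥ x := by
        simp only [dotProduct]; fun_prop
      have ho : IsOpen (Metric.ball (0 : Fin n → ℝ) 1 ∩ {x | v ⬝ᵥ x ≠ 0}) :=
        Metric.isOpen_ball.inter (isOpen_ne_fun hc continuous_const)
      have hn : (Metric.ball (0 : Fin n → ℝ) 1 ∩ {x | v ⬝ᵥ x ≠ 0}).Nonempty := by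
        have hv' : 0 < ‖v‖ := norm_pos_iff.2 hv
        refine ⟨(2 * ‖v‖)⁻¹ • v, ?_, ?_⟩
        · rw [mem_ball_zero_iff, norm_smul, Real.norm_eq_abs, abs_of_pos (by positivity)]
          field_simp
          norm_num
        · simp only [Set.mem_setOf_eq, dotProduct_smul, smul_eq_mul]
          refine mul_ne_zero (by positivity) ?_
          rwa [Ne, dotProduct_self_eq_zero]
      refine (ho.measure_pos volume hn).trans_le (measure_mono ?_)
      rintro x ⟨hx1, hx2⟩
      rw [Function.mem_support, e2]
      exact mul_ne_zero (pow_ne_zero _ hx2) (hb x hx1).ne'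
    · intro x
      simp only [Pi.zero_apply, e2]
      exact mul_nonneg (sq_nonneg _) (h0 x)

open scoped MatrixOrder in
lemma posDef_factor {n : ℕ} {G : Matrix (Fin n) (Fin n) ℝ} (hG : G.PosDef) :
    ∃ B : Matrix (Fin n) (Fin n) ℝ, IsUnit B.det ∧ G = Bᵀ * B := by
  obtain ⟨B, hB⟩ := CStarAlgebra.nonneg_iff_eq_star_mul_self.mp hG.posSemidef.nonneg
  rw [Matrix.star_eq_conjTranspose, Matrix.conjTranspose_eq_transpose_of_trivial] at hB
  refine ⟨B, ?_, hB⟩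
  have := hG.det_pos
  rw [hB, Matrix.det_mul, Matrix.det_transpose] at this
  exact isUnit_iff_ne_zero.2 fun h => by simp [h] at this

lemma posDef_congr {n : ℕ} {K G : Matrix (Fin n) (Fin n) ℝ} (hK : K.PosDef) (hG : G.PosDef) :
    ∃ M : Matrix (Fin n) (Fin n) ℝ, M.det ≠ 0 ∧ M * K * Mᵀ = G := by
  obtain ⟨B, hB, rfl⟩ := posDef_factor hG
  obtain ⟨C, hC, rfl⟩ := posDef_factor hK
  have hC' : IsUnit (Cᵀ).det := by rwa [Matrix.det_transpose]
  refine ⟨Bᵀ * Cᵀ⁻¹, ?_, ?_⟩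
  · rw [Matrix.det_mul, Matrix.det_transpose]
    exact mul_ne_zero hB.ne_zero (Matrix.isUnit_nonsing_inv_det _ hC').ne_zero
  · rw [Matrix.transpose_mul, Matrix.transpose_transpose, Matrix.transpose_nonsing_inv,
      Matrix.transpose_transpose]
    calc Bᵀ * Cᵀ⁻¹ * (Cᵀ * C) * (C⁻¹ * B) = Bᵀ * (Cᵀ⁻¹ * Cᵀ) * (C * C⁻¹) * B := by
          simp only [Matrix.mul_assoc]
      _ = Bᵀ * B := by
          rw [Matrix.nonsing_inv_mul _ hC', Matrix.mul_nonsing_inv _ hC]; simp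

lemma feasible {n : ℕ} {U : (Fin n → ℝ) → ℝ} (hU : SuperQuadratic U)
    {G : Matrix (Fin n) (Fin n) ℝ} (hG : G.PosDef) :
    ∃ ρ : (Fin n → ℝ) → ℝ, IsGoodDensity ρ ∧ (Integrable fun x => U x * ρ x) ∧
      momMatrix ρ = G := by
  set B : Set (Fin n → ℝ) := Metric.closedBall 0 1 with hBdef
  have hBc : IsCompact B := isCompact_closedBall _ _
  have hBm : MeasurableSet B := hBc.measurableSet
  set V : ℝ := volume.real B with hVdef
  have hV : 0 < V := by
    apply ENNReal.toReal_pos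
    · exact (Metric.measure_closedBall_pos volume _ one_pos).ne'
    · exact hBc.measure_lt_top.ne
  have hind : ∀ (S : Set (Fin n → ℝ)) (c : ℝ) (f : (Fin n → ℝ) → ℝ),
      (fun x => f x * S.indicator (fun _ => c) x) = S.indicator (fun x => f x * c) := by
    intro S c f; funext x
    by_cases hx : x ∈ S <;> simp [hx]
  set K := momMatrix (B.indicator fun _ => (1 : ℝ)) with hKdef
  have hKi : ∀ i j : Fin n, Integrable fun x : Fin n → ℝ =>
      x i * x j * B.indicator (fun _ => (1 : ℝ)) x := by
    intro i j
    rw [hind B 1 fun x => x i * x j, integrable_indicator_iff hBm]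
    exact ContinuousOn.integrableOn_compact hBc (by fun_prop)
  have hK : K.PosDef := by
    refine mom_posDef hKi (fun x => Set.indicator_nonneg (fun _ _ => zero_le_one) x) ?_
    intro x hx
    rw [Set.indicator_of_mem (Metric.ball_subset_closedBall hx)]
    exact one_pos
  obtain ⟨M, hM, hMK⟩ := posDef_congr hK (hG.smul hV)
  set f : (Fin n → ℝ) →L[ℝ] (Fin n → ℝ) := (Matrix.toLin' M).toContinuousLinearMap with hf
  have hfa : ∀ x, f x = M *ᵥ x := fun x => by simp [hf]
  have hfd : f.det = M.det := by
    rw [hf, LinearMap.det_toContinuousLinearMap, LinearMap.det_toLin']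
  have hfi : Function.Injective f := by
    intro x y hxy
    rw [hfa, hfa] at hxy
    exact Matrix.mulVec_injective_iff_isUnit.2
      ((Matrix.isUnit_iff_isUnit_det _).2 (isUnit_iff_ne_zero.2 hM)) hxy
  set S := f '' B with hS
  have hSc : IsCompact S := hBc.image f.continuous
  have hSm : MeasurableSet S := hSc.measurableSet
  have hcv : ∀ g : (Fin n → ℝ) → ℝ, ∫ x in S, g x = |M.det| * ∫ x in B, g (f x) := by
    intro g
    rw [hS, integral_image_eq_integral_abs_det_fderiv_smul volume hBm
      (fun x _ => f.hasFDerivWithinAt) hfi.injOn g]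
    simp only [hfd, smul_eq_mul]
    rw [integral_const_mul]
  have hdet : 0 < |M.det| := abs_pos.2 hM
  set c : ℝ := (|M.det| * V)⁻¹ with hc
  have hc0 : 0 < c := by positivity
  refine ⟨S.indicator fun _ => c, ⟨measurable_const.indicator hSm,
    fun x => Set.indicator_nonneg (fun _ _ => hc0.le) x, ?_, ?_, ?_⟩, ?_, ?_⟩
  · rw [integral_indicator hSm, hcv]
    simp only [integral_const, smul_eq_mul, measureReal_restrict_apply_univ]
    rw [← hVdef, ← mul_assoc, hc, mul_inv_cancel₀ (by positivity)]
  · intro i j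
    rw [hind S c fun x => x i * x j, integrable_indicator_iff hSm]
    exact ContinuousOn.integrableOn_compact hSc (by fun_prop)
  · have : (fun x => S.indicator (fun _ => c) x * Real.log (S.indicator (fun _ => c) x)) =
        S.indicator fun _ => c * Real.log c := by
      funext x
      by_cases hx : x ∈ S <;> simp [hx]
    rw [this, integrable_indicator_iff hSm]
    exact ContinuousOn.integrableOn_compact hSc (by fun_prop)
  · rw [hind S c U, integrable_indicator_iff hSm]
    have := hU.1
    exact ContinuousOn.integrableOn_compact hSc (by fun_prop)
  · ext i j
    have hij : (M * K * Mᵀ) i j = (V • G) i j := by rw [hMK]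
    have hKe : ∀ a b, K a b = ∫ x in B, x a * x b := by
      intro a b
      rw [hKdef, momMatrix, Matrix.of_apply, hind B 1 fun x => x a * x b, integral_indicator hBm]
      simp
    have hint : ∀ a b, Integrable (fun x : Fin n → ℝ => M i a * M j b * (x a * x b))
        (volume.restrict B) := by
      intro a b
      exact ContinuousOn.integrableOn_compact hBc (by fun_prop)
    have e1 : ∫ x in B, f x i * f x j = (M * K * Mᵀ) i j := by
      have : (fun x => f x i * f x j) =
          fun x => ∑ a, ∑ b, M i a * M j b * (x a * x b) := by
        funext x
        simp only [hfa, mulVec, dotProduct, Finset.sum_mul_sum]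
        refine Finset.sum_congr rfl fun a _ => Finset.sum_congr rfl fun b _ => by ring
      rw [this, integral_finsetSum (f := fun a (x : Fin n → ℝ) => ∑ b, M i a * M j b * (x a * x b)) _
        fun a _ => integrable_finsetSum _ fun b _ => hint a b]
      simp only [Matrix.mul_apply, Finset.sum_mul, Matrix.transpose_apply]
      rw [Finset.sum_comm]
      refine Finset.sum_congr rfl fun a _ => ?_
      rw [integral_finsetSum (f := fun b (x : Fin n → ℝ) => M i a * M j b * (x a * x b)) _
        fun b _ => hint a b]
      refine Finset.sum_congr rfl fun b _ => ?_
      rw [integral_const_mul, hKe]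
      ring
    rw [momMatrix, Matrix.of_apply, hind S c fun x => x i * x j, integral_indicator hSm, hcv,
      integral_mul_const, e1, hij, Matrix.smul_apply, smul_eq_mul, hc]
    field_simp

lemma bdd_F {n : ℕ} {U : (Fin n → ℝ) → ℝ} (hU : SuperQuadratic U)
    (G A : Matrix (Fin n) (Fin n) ℝ) :
    ∀ r ∈ { r : ℝ | ∃ ρ : (Fin n → ℝ) → ℝ, IsGoodDensity ρ ∧
      (Integrable fun x => U x * ρ x) ∧ momMatrix ρ = G ∧
      r = entropy ρ - ∫ x, U x * ρ x }, r ≤ 1 / 2 * (A * G).trace - Omega n U A := by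
  rintro r ⟨ρ, h1, h2, rfl, rfl⟩
  exact gibbs hU A h1 h2

lemma le_F {n : ℕ} {U : (Fin n → ℝ) → ℝ} (hU : SuperQuadratic U)
    {G : Matrix (Fin n) (Fin n) ℝ} {ρ : (Fin n → ℝ) → ℝ} (h1 : IsGoodDensity ρ)
    (h2 : Integrable fun x => U x * ρ x) (h3 : momMatrix ρ = G) :
    entropy ρ - ∫ x, U x * ρ x ≤ Ffun n U G :=
  le_csSup ⟨_, bdd_F hU G 0⟩ ⟨ρ, h1, h2, h3, rfl⟩

lemma F_le {n : ℕ} {U : (Fin n → ℝ) → ℝ} (hU : SuperQuadratic U)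
    {G : Matrix (Fin n) (Fin n) ℝ} (hG : G.PosDef) (A : Matrix (Fin n) (Fin n) ℝ) :
    Ffun n U G ≤ 1 / 2 * (A * G).trace - Omega n U A := by
  obtain ⟨ρ, h1, h2, h3⟩ := feasible hU hG
  exact csSup_le ⟨_, ρ, h1, h2, h3, rfl⟩ (bdd_F hU G A)

lemma xlogx_sub {a b : ℝ} (ha : 0 ≤ a) (hb : 0 ≤ b) :
    a * Real.log a + b * Real.log b ≤ (a + b) * Real.log (a + b) := by
  rcases ha.eq_or_lt with h | h
  · simp [← h]
  rcases hb.eq_or_lt with h' | h'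
  · simp [← h']
  have h1 := Real.log_le_log h (by linarith : a ≤ a + b)
  have h2 := Real.log_le_log h' (by linarith : b ≤ a + b)
  nlinarith

lemma mix {n : ℕ} {U : (Fin n → ℝ) → ℝ} {ρ σ : (Fin n → ℝ) → ℝ} (h : IsGoodDensity ρ)
    (hu : Integrable fun x => U x * ρ x) (h' : IsGoodDensity σ)
    (hu' : Integrable fun x => U x * σ x) {s t : ℝ} (hs : 0 < s) (ht : 0 < t) (hst : s + t = 1) :
    ∃ τ : (Fin n → ℝ) → ℝ, IsGoodDensity τ ∧ (Integrable fun x => U x * τ x) ∧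
      momMatrix τ = s • momMatrix ρ + t • momMatrix σ ∧
      s * (entropy ρ - ∫ x, U x * ρ x) + t * (entropy σ - ∫ x, U x * σ x) ≤
        entropy τ - ∫ x, U x * τ x := by
  have hi := good_int h
  have hi' := good_int h'
  obtain ⟨m, p, e, q, l⟩ := h
  obtain ⟨m', p', e', q', l'⟩ := h'
  set τ : (Fin n → ℝ) → ℝ := fun x => s * ρ x + t * σ x with hτ
  have hτm : Measurable τ := (m.const_mul s).add (m'.const_mul t)
  have hup : ∀ x, τ x * Real.log (τ x) ≤
      s * (ρ x * Real.log (ρ x)) + t * (σ x * Real.log (σ x)) := by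
    intro x
    have := Real.convexOn_mul_log.2 (p x) (p' x) hs.le ht.le hst
    simpa [hτ] using this
  have hlo : ∀ x, s * (ρ x * Real.log (ρ x)) + t * (σ x * Real.log (σ x)) +
      ((s * Real.log s) * ρ x + (t * Real.log t) * σ x) ≤ τ x * Real.log (τ x) := by
    intro x
    have h1 := xlogx_sub (mul_nonneg hs.le (p x)) (mul_nonneg ht.le (p' x))
    have aux : ∀ {s y : ℝ}, 0 < s → (s * y) * Real.log (s * y) =
        s * (y * Real.log y) + s * Real.log s * y := by
      intro s y hs
      by_cases hy : y = 0
      · simp [hy]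
      · rw [Real.log_mul hs.ne' hy]; ring
    rw [aux hs, aux ht] at h1
    simp only [hτ]
    linarith
  have iu : Integrable fun x => s * (ρ x * Real.log (ρ x)) + t * (σ x * Real.log (σ x)) :=
    (l.const_mul s).add (l'.const_mul t)
  have il : Integrable fun x => (s * Real.log s) * ρ x + (t * Real.log t) * σ x :=
    (hi.const_mul _).add (hi'.const_mul _)
  have iτ : Integrable fun x => τ x * Real.log (τ x) := by
    refine (iu.abs.add il.abs).mono'
      (hτm.mul (Real.measurable_log.comp hτm)).aestronglyMeasurable (ae_of_all _ fun x => ?_)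
    have h1 := hup x
    have h2 := hlo x
    rw [Real.norm_eq_abs]
    simp only [Pi.add_apply]
    set X := s * (ρ x * Real.log (ρ x)) + t * (σ x * Real.log (σ x))
    set Y := (s * Real.log s) * ρ x + (t * Real.log t) * σ x
    have := neg_abs_le X
    have := le_abs_self X
    have := neg_abs_le Y
    have := abs_nonneg Y
    exact abs_le.2 ⟨by linarith, by linarith⟩
  have eU : (fun x => U x * τ x) = fun x => s * (U x * ρ x) + t * (U x * σ x) := by
    funext x; simp only [hτ]; ring
  have em : ∀ i j, (fun x : Fin n → ℝ => x i * x j * τ x) =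
      fun x => s * (x i * x j * ρ x) + t * (x i * x j * σ x) := by
    intro i j; funext x; simp only [hτ]; ring
  refine ⟨τ, ⟨hτm, fun x => add_nonneg (mul_nonneg hs.le (p x)) (mul_nonneg ht.le (p' x)), ?_, ?_,
    iτ⟩, ?_, ?_, ?_⟩
  · rw [hτ, integral_add (hi.const_mul _) (hi'.const_mul _), integral_const_mul,
      integral_const_mul, e, e']
    linarith
  · intro i j
    rw [em]
    exact ((q i j).const_mul _).add ((q' i j).const_mul _)
  · rw [eU]
    exact (hu.const_mul _).add (hu'.const_mul _)
  · ext i j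
    simp only [momMatrix, Matrix.add_apply, Matrix.smul_apply, Matrix.of_apply, smul_eq_mul]
    rw [em, integral_add ((q i j).const_mul _) ((q' i j).const_mul _), integral_const_mul,
      integral_const_mul]
  · rw [eU, integral_add (hu.const_mul _) (hu'.const_mul _), integral_const_mul,
      integral_const_mul]
    have h1 := integral_mono iτ iu hup
    rw [integral_add (l.const_mul s) (l'.const_mul t), integral_const_mul,
      integral_const_mul] at h1
    simp only [entropy]
    linarith

lemma tp_apply {n : ℕ} (S H : Matrix (Fin n) (Fin n) ℝ) : tracePairing S H = (S * H).trace := rfl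

lemma symm_eq {n : ℕ} {S T : Matrix (Fin n) (Fin n) ℝ} (hS : S.IsSymm) (hT : T.IsSymm)
    (h : ∀ H : Matrix (Fin n) (Fin n) ℝ, H.IsSymm → (S * H).trace = (T * H).trace) : S = T := by
  have hD : (S - T).IsSymm := hS.sub hT
  have h1 := h _ hD
  rw [← sub_eq_zero, ← Matrix.trace_sub, ← Matrix.sub_mul] at h1
  have h2 : ((S - T)ᴴ * (S - T)).trace = 0 := by
    rw [Matrix.conjTranspose_eq_transpose_of_trivial, hD.eq]; exact h1
  exact sub_eq_zero.1 (Matrix.trace_conjTranspose_mul_self_eq_zero_iff.1 h2)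

lemma line_deriv {n : ℕ} {f : Matrix (Fin n) (Fin n) ℝ → ℝ} {S G H : Matrix (Fin n) (Fin n) ℝ}
    (hG : G.IsSymm) (hH : H.IsSymm)
    (hf : HasFDerivWithinAt f (tracePairing S) {M : Matrix (Fin n) (Fin n) ℝ | M.IsSymm} G) :
    HasDerivAt (fun t : ℝ => f (G + t • H)) ((S * H).trace) 0 := by
  have hl : HasDerivAt (fun t : ℝ => G + t • H) H 0 := by
    have h0 := ((hasDerivAt_id (0 : ℝ)).smul_const H).const_add G
    rw [one_smul] at h0
    exact h0
  have hf' : HasFDerivWithinAt f (tracePairing S) {M : Matrix (Fin n) (Fin n) ℝ | M.IsSymm}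
      (G + (0 : ℝ) • H) := by simpa using hf
  have := hf'.comp_hasDerivWithinAt (s := Set.univ) (0 : ℝ) hl.hasDerivWithinAt
    (fun t _ => hG.add (hH.smul t))
  rw [hasDerivWithinAt_univ] at this
  exact this

lemma DOmega_eq {n : ℕ} {U : (Fin n → ℝ) → ℝ} {A D G : Matrix (Fin n) (Fin n) ℝ}
    (hA : A.IsSymm) (hD : D.IsSymm) (hG : G.IsSymm)
    (hd : HasFDerivAt (Omega n U) (tracePairing ((1 / 2 : ℝ) • D)) A)
    (hmin : ∀ B, 1 / 2 * (A * G).trace - Omega n U A ≤ 1 / 2 * (B * G).trace - Omega n U B) :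
    D = G := by
  refine symm_eq hD hG fun H hH => ?_
  have h1 := line_deriv hA hH hd.hasFDerivWithinAt
  have h2 : HasDerivAt (fun t : ℝ => 1 / 2 * ((A + t • H) * G).trace)
      (1 / 2 * (H * G).trace) 0 := by
    have : (fun t : ℝ => 1 / 2 * ((A + t • H) * G).trace) =
        fun t : ℝ => 1 / 2 * (A * G).trace + t * (1 / 2 * (H * G).trace) := by
      funext t
      rw [Matrix.add_mul, Matrix.trace_add, Matrix.smul_mul, Matrix.trace_smul, smul_eq_mul]
      ring
    rw [this]
    simpa using ((hasDerivAt_id (0 : ℝ)).mul_const (1 / 2 * (H * G).trace)).const_add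
      (1 / 2 * (A * G).trace)
  have hm : IsLocalMin ((fun t : ℝ => 1 / 2 * ((A + t • H) * G).trace) -
      fun t : ℝ => Omega n U (A + t • H)) 0 := by
    refine Eventually.of_forall fun t => ?_
    simpa using hmin (A + t • H)
  have h3 := hm.hasDerivAt_eq_zero (h2.sub h1)
  rw [Matrix.smul_mul, Matrix.trace_smul, smul_eq_mul, Matrix.trace_mul_comm H G] at h3
  linarith

lemma posDef_pert {n : ℕ} {G H : Matrix (Fin n) (Fin n) ℝ} (hG : G.PosDef) (hH : H.IsSymm) :
    ∀ᶠ t : ℝ in 𝓝 0, (G + t • H).PosDef := by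
  have hcG := qf_cont G
  obtain ⟨m, hm, hmb⟩ : ∃ m : ℝ, 0 < m ∧ ∀ x : Fin n → ℝ, ‖x‖ = 1 → m ≤ x ⬝ᵥ G.mulVec x := by
    rcases (Metric.sphere (0 : Fin n → ℝ) 1).eq_empty_or_nonempty with he | he
    · refine ⟨1, one_pos, fun x hx => ?_⟩
      have : x ∈ Metric.sphere (0 : Fin n → ℝ) 1 := by simpa using hx
      rw [he] at this
      exact this.elim
    · obtain ⟨x0, hx0, hmin⟩ := (isCompact_sphere (0 : Fin n → ℝ) 1).exists_isMinOn he
        hcG.continuousOn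
      refine ⟨_, ?_, fun x hx => hmin (by simpa using hx)⟩
      have hx0' : ‖x0‖ = 1 := by simpa using hx0
      have : x0 ≠ 0 := by
        rintro rfl; simp at hx0'
      simpa using hG.dotProduct_mulVec_pos this
  set C := ∑ i, ∑ j, |H i j| with hC
  have hlim : Tendsto (fun t : ℝ => |t| * C) (𝓝 0) (𝓝 0) := by
    have : Continuous fun t : ℝ => |t| * C := by fun_prop
    simpa using this.tendsto 0
  filter_upwards [hlim.eventually_lt_const hm] with t ht
  refine Matrix.PosDef.of_dotProduct_mulVec_pos ?_ ?_
  · have h1 : G.IsSymm := by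
      have := hG.isHermitian
      rwa [Matrix.IsHermitian, Matrix.conjTranspose_eq_transpose_of_trivial] at this
    rw [Matrix.IsHermitian, Matrix.conjTranspose_eq_transpose_of_trivial]
    exact h1.add (hH.smul t)
  · intro v hv
    have hv' : 0 < ‖v‖ := norm_pos_iff.2 hv
    set x := ‖v‖⁻¹ • v with hx
    have hx1 : ‖x‖ = 1 := by
      rw [hx, norm_smul, norm_inv, norm_norm, inv_mul_cancel₀ hv'.ne']
    have hvx : v = ‖v‖ • x := by
      rw [hx, smul_smul, mul_inv_cancel₀ hv'.ne', one_smul]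
    have e : star v ⬝ᵥ ((G + t • H) *ᵥ v) =
        ‖v‖ ^ 2 * (x ⬝ᵥ G.mulVec x + t * (x ⬝ᵥ H.mulVec x)) := by
      rw [star_trivial]
      conv_lhs => rw [hvx]
      simp only [Matrix.add_mulVec, Matrix.smul_mulVec, Matrix.mulVec_smul, dotProduct_add,
        dotProduct_smul, smul_dotProduct, smul_eq_mul]
      ring
    rw [e]
    have h1 := hmb x hx1
    have h2 := qf_bound H x
    rw [hx1, one_pow, mul_one] at h2
    have h3 : |t * (x ⬝ᵥ H.mulVec x)| ≤ |t| * C := by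
      rw [abs_mul]; exact mul_le_mul_of_nonneg_left h2 (abs_nonneg t)
    have h4 := neg_abs_le (t * (x ⬝ᵥ H.mulVec x))
    have : 0 < x ⬝ᵥ G.mulVec x + t * (x ⬝ᵥ H.mulVec x) := by linarith
    positivity

lemma PosDef_symm {n : ℕ} {G : Matrix (Fin n) (Fin n) ℝ} (hG : G.PosDef) : G.IsSymm := by
  have := hG.isHermitian
  rwa [Matrix.IsHermitian, Matrix.conjTranspose_eq_transpose_of_trivial] at this

lemma gd_posDef {n : ℕ} {U : (Fin n → ℝ) → ℝ} (hU : SuperQuadratic U)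
    (A : Matrix (Fin n) (Fin n) ℝ) : (momMatrix (gd U A)).PosDef :=
  mom_posDef (gd_mom_int hU A) (fun x => (gd_pos hU A x).le) fun x _ => gd_pos hU A x

lemma DF_eq {n : ℕ} {U : (Fin n → ℝ) → ℝ} (hU : SuperQuadratic U)
    {A D : Matrix (Fin n) (Fin n) ℝ} (hA : A.IsSymm) (hD : D.IsSymm)
    (hd : HasFDerivWithinAt (Ffun n U) (tracePairing ((1 / 2 : ℝ) • D))
        {M : Matrix (Fin n) (Fin n) ℝ | M.IsSymm} (momMatrix (gd U A))) : D = A := by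
  refine symm_eq hD hA fun H hH => ?_
  set G := momMatrix (gd U A) with hG
  have hGp : G.PosDef := gd_posDef hU A
  have h1 := line_deriv (PosDef_symm hGp) hH hd
  have h2 : HasDerivAt (fun t : ℝ => 1 / 2 * (A * (G + t • H)).trace)
      (1 / 2 * (A * H).trace) 0 := by
    have : (fun t : ℝ => 1 / 2 * (A * (G + t • H)).trace) =
        fun t : ℝ => 1 / 2 * (A * G).trace + t * (1 / 2 * (A * H).trace) := by
      funext t
      rw [Matrix.mul_add, Matrix.trace_add, Matrix.mul_smul, Matrix.trace_smul, smul_eq_mul]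
      ring
    rw [this]
    simpa using ((hasDerivAt_id (0 : ℝ)).mul_const (1 / 2 * (A * H).trace)).const_add
      (1 / 2 * (A * G).trace)
  have hv : 1 / 2 * (A * G).trace - Omega n U A ≤ Ffun n U G := by
    rw [hG, ← gd_val hU]
    exact le_F hU (gd_good hU A) (gd_U_int hU A) rfl
  have hm : IsLocalMin ((fun t : ℝ => 1 / 2 * (A * (G + t • H)).trace) -
      fun t : ℝ => Ffun n U (G + t • H)) 0 := by
    filter_upwards [posDef_pert hGp hH] with t ht
    have := F_le hU ht A
    simp only [Pi.sub_apply, zero_smul, add_zero]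
    linarith
  have h3 := hm.hasDerivAt_eq_zero (h2.sub h1)
  rw [Matrix.smul_mul, Matrix.trace_smul, smul_eq_mul] at h3
  linarith

lemma deriv_ge {g : ℝ → ℝ} {g' k : ℝ} (hg : HasDerivAt g g' 0)
    (h : ∀ t, 0 < t → t < 1 → g 0 + t * k ≤ g t) : k ≤ g' := by
  have h1 := (hasDerivAt_iff_tendsto_slope.1 hg).mono_left
    (nhdsWithin_mono (0 : ℝ) (fun t (ht : t ∈ Set.Ioi (0 : ℝ)) => (ne_of_gt ht : t ≠ 0)))
  refine ge_of_tendsto h1 ?_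
  filter_upwards [Ioo_mem_nhdsGT (zero_lt_one (α := ℝ))] with t ht
  rw [slope_def_field, sub_zero, le_div_iff₀ ht.1]
  have := h t ht.1 ht.2
  linarith

lemma F_grad {n : ℕ} {U : (Fin n → ℝ) → ℝ} (hU : SuperQuadratic U)
    {G A : Matrix (Fin n) (Fin n) ℝ} (hG : G.PosDef)
    (hd : HasFDerivWithinAt (Ffun n U) (tracePairing ((1 / 2 : ℝ) • A))
        {M : Matrix (Fin n) (Fin n) ℝ | M.IsSymm} G) :
    1 / 2 * (A * G).trace - Omega n U A ≤ Ffun n U G := by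
  set K := momMatrix (gd U A) with hK
  have hGs := PosDef_symm hG
  have h1 := line_deriv hGs ((mom_symm (gd U A)).sub hGs) hd
  have h2 := deriv_ge (k := (1 / 2 * (A * K).trace - Omega n U A) - Ffun n U G) h1 ?_
  · rw [Matrix.smul_mul, Matrix.trace_smul, smul_eq_mul, Matrix.mul_sub, Matrix.trace_sub] at h2
    linarith
  · intro t ht ht1
    simp only [zero_smul, add_zero]
    have h1t : 0 < 1 - t := by linarith
    have key : Ffun n U G ≤
        (Ffun n U (G + t • (K - G)) - t * (1 / 2 * (A * K).trace - Omega n U A)) / (1 - t) := by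
      obtain ⟨ρ0, a1, a2, a3⟩ := feasible hU hG
      refine csSup_le ⟨_, ρ0, a1, a2, a3, rfl⟩ ?_
      rintro r ⟨ρ, b1, b2, b3, rfl⟩
      obtain ⟨τ, c1, c2, c3, c4⟩ := mix b1 b2 (gd_good hU A) (gd_U_int hU A) h1t ht (by ring)
      rw [gd_val hU] at c4
      have hmom : momMatrix τ = G + t • (K - G) := by
        rw [c3, b3, ← hK]
        module
      have := le_F hU c1 c2 hmom
      rw [le_div_iff₀ h1t]
      linarith
    rw [le_div_iff₀ h1t] at key
    linarith

/-- the gradient map `A ↦ ∇Ω[A]` (here `DOmega`, characterized by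
`dΩ[A][H] = ½ Tr[H ⋅ DOmega A]`, i.e. the gradient w.r.t. the pairing `⟨A,G⟩ = ½Tr[AG]`)
is a bijection from the symmetric matrices onto the symmetric positive definite
matrices, with inverse the gradient map `G ↦ ∇𝓕[G]` (here `DF`, characterized
analogously as the gradient of `𝓕` along the subspace of symmetric matrices). -/
theorem statement4 (n : ℕ) (hn : 1 ≤ n) (U : (Fin n → ℝ) → ℝ) (hU : SuperQuadratic U)
    (DOmega DF : Matrix (Fin n) (Fin n) ℝ → Matrix (Fin n) (Fin n) ℝ)
    (hDOmega : ∀ A : Matrix (Fin n) (Fin n) ℝ, A.IsSymm → (DOmega A).IsSymm ∧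
      HasFDerivAt (Omega n U) (tracePairing ((1 / 2 : ℝ) • DOmega A)) A)
    (hDF : ∀ G : Matrix (Fin n) (Fin n) ℝ, G.PosDef → (DF G).IsSymm ∧
      HasFDerivWithinAt (Ffun n U) (tracePairing ((1 / 2 : ℝ) • DF G))
        {M : Matrix (Fin n) (Fin n) ℝ | M.IsSymm} G) :
    Set.BijOn DOmega {A : Matrix (Fin n) (Fin n) ℝ | A.IsSymm}
      {G : Matrix (Fin n) (Fin n) ℝ | G.PosDef} ∧
    (∀ A : Matrix (Fin n) (Fin n) ℝ, A.IsSymm → DF (DOmega A) = A) ∧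
    (∀ G : Matrix (Fin n) (Fin n) ℝ, G.PosDef → DOmega (DF G) = G) := by
  have hmin : ∀ A B : Matrix (Fin n) (Fin n) ℝ,
      1 / 2 * (A * momMatrix (gd U A)).trace - Omega n U A ≤
        1 / 2 * (B * momMatrix (gd U A)).trace - Omega n U B := by
    intro A B
    rw [← gd_val hU]
    exact gibbs hU B (gd_good hU A) (gd_U_int hU A)
  have hO : ∀ A : Matrix (Fin n) (Fin n) ℝ, A.IsSymm → DOmega A = momMatrix (gd U A) :=
    fun A hA => DOmega_eq hA (hDOmega A hA).1 (mom_symm _) (hDOmega A hA).2 (hmin A)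
  have hL : ∀ A : Matrix (Fin n) (Fin n) ℝ, A.IsSymm → DF (DOmega A) = A := by
    intro A hA
    rw [hO A hA]
    have h := hDF _ (gd_posDef hU A)
    exact DF_eq hU hA h.1 h.2
  have hR : ∀ G : Matrix (Fin n) (Fin n) ℝ, G.PosDef → DOmega (DF G) = G := by
    intro G hG
    have h := hDF G hG
    have h' := hDOmega _ h.1
    exact DOmega_eq h.1 h'.1 (PosDef_symm hG) h'.2 fun B =>
      (F_grad hU hG h.2).trans (F_le hU hG B)
  refine ⟨⟨?_, ?_, ?_⟩, hL, hR⟩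
  · intro A hA
    simp only [Set.mem_setOf_eq] at hA ⊢
    rw [hO A hA]
    exact gd_posDef hU A
  · intro A hA B hB hAB
    rw [← hL A hA, hAB, hL B hB]
  · intro G hG
    exact ⟨DF G, (hDF G hG).1, hR G hG⟩
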